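/- Let s ∈ (1/2, 1] and let x ∈ (0,1) be irrational with continued fraction convergents (p_j/q_j)_{j≥1}. If the limsup, taken over those indices j with q_j ≢ 2 (mod 4), of δ_j √(q_{j+1}/(q_j q_{j+1})^s) is strictly positive, then the sequence of partial sums F_{s,N}(x) does not converge as N → ∞. -/

import Mathlib

open MeasureTheory Filter Set
open scoped Real BigOperators ENNReal

/-- Partial sum `F_{s,N}(x) = ∑_{n=1}^N n^{-s} e^{2πi n² x}`. -/
noncomputable def FsN (s : ℝ) (N : ℕ) (x : ℝ) : ℂ :=
  ∑ n ∈ Finset.Icc 1 N,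
    (((n : ℝ) ^ (-s) : ℝ) : ℂ) * Complex.exp (2 * Real.pi * Complex.I * (n : ℂ) ^ 2 * (x : ℂ))

/-- Iterates of the Gauss map: `cfX x 0 = x`, `cfX x (j+1) = frac (1 / cfX x j)`. -/
noncomputable def cfX (x : ℝ) : ℕ → ℝ
  | 0 => x
  | j + 1 => Int.fract (cfX x j)⁻¹

/-- Partial quotients: `cfA x j = a_{j+1} = ⌊1 / x_j⌋`. -/
noncomputable def cfA (x : ℝ) (j : ℕ) : ℤ := ⌊(cfX x j)⁻¹⌋

/-- Numerators of the convergents of x ∈ (0,1): `p_0 = 0`, `p_1 = 1`,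
`p_{j+2} = a_{j+2} p_{j+1} + p_j`. -/
noncomputable def cfP (x : ℝ) : ℕ → ℤ
  | 0 => 0
  | 1 => 1
  | j + 2 => cfA x (j + 1) * cfP x (j + 1) + cfP x j

/-- Denominators of the convergents of x ∈ (0,1): `q_0 = 1`, `q_1 = a_1`,
`q_{j+2} = a_{j+2} q_{j+1} + q_j`. -/
noncomputable def cfQ (x : ℝ) : ℕ → ℤ
  | 0 => 1
  | 1 => cfA x 0
  | j + 2 => cfA x (j + 1) * cfQ x (j + 1) + cfQ x j

/-- `h_j = x - p_j/q_j`. -/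
noncomputable def cfH (x : ℝ) (j : ℕ) : ℝ := x - (cfP x j : ℝ) / (cfQ x j : ℝ)

/-- `r_j`, defined by `|h_j| = q_j^{-r_j}`, i.e. `r_j = -log_{q_j} |h_j|`. -/
noncomputable def cfR (x : ℝ) (j : ℕ) : ℝ := -Real.logb (cfQ x j : ℝ) |cfH x j|

/-- The filter of large indices `j ≥ 1` whose convergent denominator `q_j` is not
twice an odd number (i.e. `q_j ≢ 2 [MOD 4]`). -/
def oddFilter (x : ℝ) : Filter ℕ :=
  Filter.atTop ⊓ Filter.principal {j : ℕ | 1 ≤ j ∧ cfQ x j % 4 ≠ 2}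

/-- The approximation rate `r_odd(x) ∈ [2,∞]`: the limsup of the `r_j` over indices `j`
with `q_j ≢ 2 [MOD 4]`. -/
noncomputable def rOdd (x : ℝ) : ℝ≥0∞ :=
  Filter.limsup (fun j => ENNReal.ofReal (cfR x j)) (oddFilter x)

/-- `δ_j`: equal to `1` when `s < 1`, and to `log (q_{j+1}/q_j)` when `s = 1`. -/
noncomputable def deltaJ (s x : ℝ) (j : ℕ) : ℝ :=
  if s < 1 then 1 else Real.log ((cfQ x (j + 1) : ℝ) / (cfQ x j : ℝ))

/-- The summand `δ_j √(q_{j+1} / (q_j q_{j+1})^s)`. -/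
noncomputable def sigTerm (s x : ℝ) (j : ℕ) : ℝ :=
  deltaJ s x j *
    Real.sqrt ((cfQ x (j + 1) : ℝ) / ((cfQ x j : ℝ) * (cfQ x (j + 1) : ℝ)) ^ s)

/-- `Σ_s(x) = ∑_{j ≥ 1, q_j ≢ 2 (4)} δ_j √(q_{j+1}/(q_j q_{j+1})^s)`, valued in `[0,∞]`. -/
noncomputable def SigmaS (s x : ℝ) : ℝ≥0∞ :=
  ∑' j : ℕ, if 1 ≤ j ∧ cfQ x j % 4 ≠ 2 then ENNReal.ofReal (sigTerm s x j) else 0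

lemma cfX_mem (x : ℝ) (hx : x ∈ Set.Ioo (0 : ℝ) 1) (hirr : Irrational x) (j : ℕ) :
    Irrational (cfX x j) ∧ 0 < cfX x j ∧ cfX x j < 1 := by
  induction j with
  | zero => exact ⟨hirr, hx.1, hx.2⟩
  | succ j ih =>
    obtain ⟨h1, h2, h3⟩ := ih
    have hi : Irrational (Int.fract (cfX x j)⁻¹) := by
      have := h1.inv
      rw [Int.fract]
      exact this.sub_intCast _
    refine ⟨hi, ?_, Int.fract_lt_one _⟩
    exact lt_of_le_of_ne (Int.fract_nonneg _) (fun h => hi.ne_zero h.symm)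

lemma cfA_pos (x : ℝ) (hx : x ∈ Set.Ioo (0 : ℝ) 1) (hirr : Irrational x) (j : ℕ) :
    1 ≤ cfA x j := by
  obtain ⟨h1, h2, h3⟩ := cfX_mem x hx hirr j
  rw [cfA, Int.le_floor]
  have := (one_lt_inv₀ h2).2 h3
  push_cast; exact this.le

lemma cfX_inv (x : ℝ) (j : ℕ) : (cfX x j)⁻¹ = cfA x j + cfX x (j+1) := by
  rw [cfA, cfX]; exact (Int.floor_add_fract _).symm

lemma cfQ_facts (x : ℝ) (hx : x ∈ Set.Ioo (0 : ℝ) 1) (hirr : Irrational x) (j : ℕ) :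
    1 ≤ cfQ x j ∧ cfQ x j ≤ cfQ x (j+1) ∧ (j : ℤ) ≤ cfQ x (j+1) := by
  induction j with
  | zero => simp [cfQ]; have := cfA_pos x hx hirr 0; omega
  | succ j ih =>
    obtain ⟨h1, h2, h3⟩ := ih
    have := cfA_pos x hx hirr (j+1)
    have e : cfQ x (j+1+1) = cfA x (j + 1) * cfQ x (j + 1) + cfQ x j := rfl
    have : cfQ x (j+1) ≤ cfA x (j + 1) * cfQ x (j + 1) := by nlinarith
    push_cast
    refine ⟨?_, ?_, ?_⟩ <;> omega

lemma cf_det (x : ℝ) (j : ℕ) :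
    cfP x (j+1) * cfQ x j - cfP x j * cfQ x (j+1) = (-1) ^ j := by
  induction j with
  | zero => simp [cfP, cfQ]
  | succ j ih =>
    have e : cfQ x (j+1+1) = cfA x (j + 1) * cfQ x (j + 1) + cfQ x j := rfl
    have e' : cfP x (j+1+1) = cfA x (j + 1) * cfP x (j + 1) + cfP x j := rfl
    rw [e, e', pow_succ, ← ih]; ring

lemma cf_coprime (x : ℝ) (j : ℕ) : IsCoprime (cfP x j) (cfQ x j) := by
  have := cf_det x j
  refine ⟨-(-1)^j * cfQ x (j+1), (-1)^j * cfP x (j+1), ?_⟩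
  have h : ((-1 : ℤ)^j) * (-1)^j = 1 := by rw [← mul_pow]; simp
  linear_combination (-1)^j * this + h

lemma cf_id (x : ℝ) (hx : x ∈ Set.Ioo (0 : ℝ) 1) (hirr : Irrational x) (j : ℕ) :
    x * (cfQ x (j+1) + cfX x (j+1) * cfQ x j) = cfP x (j+1) + cfX x (j+1) * cfP x j := by
  induction j with
  | zero =>
    have := cfX_inv x 0
    simp only [cfP, cfQ, zero_add] at *
    push_cast
    rw [mul_one, ← this]; simp [cfX]; exact mul_inv_cancel₀ hx.1.ne'
  | succ j ih =>
    have e : cfQ x (j+1+1) = cfA x (j + 1) * cfQ x (j + 1) + cfQ x j := rfl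
    have e' : cfP x (j+1+1) = cfA x (j + 1) * cfP x (j + 1) + cfP x j := rfl
    have h := cfX_inv x (j+1)
    obtain ⟨-, h2, -⟩ := cfX_mem x hx hirr (j+1)
    have h3 : cfX x (j+1) * (cfA x (j+1) + cfX x (j+1+1)) = 1 := by
      rw [← h]; exact mul_inv_cancel₀ h2.ne'
    rw [e, e']; push_cast
    apply mul_left_cancel₀ h2.ne'
    linear_combination ih + (x * cfQ x (j+1) - cfP x (j+1)) * h3

lemma cfH_le (x : ℝ) (hx : x ∈ Set.Ioo (0 : ℝ) 1) (hirr : Irrational x) (j : ℕ) :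
    |cfH x j| ≤ 1 / (cfQ x j * cfQ x (j+1)) := by
  have h := cf_id x hx hirr j
  have hd := cf_det x j
  obtain ⟨-, h2, -⟩ := cfX_mem x hx hirr (j+1)
  obtain ⟨q1, q2, -⟩ := cfQ_facts x hx hirr j
  have hq : (1:ℝ) ≤ cfQ x j := by exact_mod_cast q1
  have hq' : (1:ℝ) ≤ cfQ x (j+1) := by exact_mod_cast q1.trans q2
  have hd' : (cfP x (j+1) * cfQ x j - cfP x j * cfQ x (j+1) : ℝ) = (-1) ^ j := by exact_mod_cast hd
  have key : cfH x j * (cfQ x j * (cfQ x (j+1) + cfX x (j+1) * cfQ x j)) = (-1)^j := by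
    rw [← hd', cfH]; field_simp
    linear_combination cfQ x j * h
  have hpos : 0 < (cfX x (j+1) * cfQ x j : ℝ) := by positivity
  have ha : |cfH x j| * (cfQ x j * (cfQ x (j+1) + cfX x (j+1) * cfQ x j)) = 1 := by
    have := congrArg abs key
    rwa [abs_mul, abs_pow, abs_neg, abs_one, one_pow,
      abs_of_pos (a := (cfQ x j * (cfQ x (j+1) + cfX x (j+1) * cfQ x j) : ℝ)) (by positivity)] at this
  rw [le_div_iff₀ (by positivity), ← ha]
  gcongr; linarith

lemma gauss_lower (q : ℕ) (p : ℤ) [NeZero q] (hc : IsCoprime p (q:ℤ)) (h4 : q % 4 ≠ 2) :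
    Real.sqrt q ≤ ‖∑ r : ZMod q, ZMod.stdAddChar ((p : ZMod q) * r ^ 2)‖ := by
  set ψ : AddChar (ZMod q) ℂ := ZMod.stdAddChar with hψ
  set G := ∑ r : ZMod q, ψ ((p : ZMod q) * r ^ 2) with hG
  have hu : IsUnit (p : ZMod q) := by
    obtain ⟨a, b, hab⟩ := hc
    have := congrArg (Int.cast : ℤ → ZMod q) hab
    push_cast at this
    rw [ZMod.natCast_self, mul_zero, add_zero] at this
    exact IsUnit.of_mul_eq_one_right _ this
  have h1 : G * (starRingEnd ℂ) G
      = ∑ d : ZMod q, if 2 * d = 0 then (q : ℂ) else 0 := by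
    rw [hG, map_sum, Finset.sum_mul_sum, Finset.sum_comm]
    calc ∑ b : ZMod q, ∑ a : ZMod q, ψ (p * a ^ 2) * (starRingEnd ℂ) (ψ (p * b^2))
        = ∑ b : ZMod q, ∑ d : ZMod q, ψ (p * d ^ 2) * ψ (b * (p * (2 * d))) := by
          refine Finset.sum_congr rfl fun b _ => ?_
          rw [← Equiv.sum_comp (Equiv.addRight b)]
          refine Finset.sum_congr rfl fun d _ => ?_
          rw [← AddChar.map_neg_eq_conj, ← AddChar.map_add_eq_mul, ← AddChar.map_add_eq_mul]
          congr 1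
          simp only [Equiv.coe_addRight]; ring
      _ = ∑ d : ZMod q, ψ (p * d ^ 2) * ∑ b : ZMod q, ψ (b * (p * (2 * d))) := by
          rw [Finset.sum_comm]; simp_rw [Finset.mul_sum]
      _ = _ := by
          refine Finset.sum_congr rfl fun d _ => ?_
          rw [AddChar.sum_mulShift _ (ZMod.isPrimitive_stdAddChar q)]
          simp only [hu.mul_right_eq_zero]
          split_ifs with h
          · have : d ^ 2 = 0 := by
              have h' : q ∣ 2 * d.val := by
                rw [← ZMod.natCast_eq_zero_iff]; push_cast
                rw [ZMod.natCast_zmod_val]; exact h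
              have : q ∣ d.val ^ 2 := by
                rcases Nat.even_or_odd q with he | ho
                · have : 4 ∣ q := by obtain ⟨k, hk⟩ := he; omega
                  obtain ⟨k, rfl⟩ := this
                  obtain ⟨m, hm⟩ := h'
                  have : d.val = 2 * k * m := by linarith
                  rw [this]; exact ⟨k * m^2, by ring⟩
                · have : q ∣ d.val := (Nat.Coprime.dvd_mul_left (by
                    exact Nat.Coprime.symm (Nat.coprime_two_left.2 ho))).1 h'
                  exact this.trans (dvd_pow_self _ two_ne_zero)
              rw [← ZMod.natCast_eq_zero_iff] at this
              push_cast at this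
              rwa [ZMod.natCast_zmod_val] at this
            rw [this]; simp [ZMod.card]
          · simp
  have h2 : (q : ℝ) ≤ ‖G‖ ^ 2 := by
    have e : ((‖G‖ ^ 2 : ℝ) : ℂ) = ((∑ d : ZMod q, if 2 * d = 0 then (q : ℝ) else 0 : ℝ) : ℂ) := by
      push_cast
      rw [← Complex.mul_conj', h1]
      refine Finset.sum_congr rfl fun d _ => ?_
      split_ifs <;> simp
    have e' := Complex.ofReal_injective e
    rw [e']
    have := Finset.single_le_sum (f := fun d : ZMod q => if 2 * d = 0 then (q : ℝ) else 0)
      (fun i _ => by split_ifs <;> positivity) (Finset.mem_univ 0)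
    simpa using this
  exact Real.sqrt_le_iff.2 ⟨norm_nonneg _, h2⟩

/-- Remainder of the dual theta series. -/
lemma theta_remainder (a : ℂ) (ha : 0 < a.re) (t : ℝ) :
    ‖(∑' n : ℤ, Complex.exp (-↑Real.pi * a * (n:ℂ) ^ 2 + 2 * Real.pi * (Complex.I * t) * n)) - 1‖
      ≤ 2 / (1 - Real.exp (-Real.pi * a.re)) * Real.exp (-Real.pi * a.re) := by
  have him : 0 < (Complex.I * (a.re : ℂ)).im := by simpa using ha
  have key := norm_jacobiTheta_sub_one_le him
  have hs := hasSum_jacobiTheta₂_term 0 him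
  set A : ℤ → ℝ := fun n => Real.exp (-Real.pi * a.re * (n:ℝ) ^ 2) with hA
  have hterm : ∀ n : ℤ, jacobiTheta₂_term n 0 (Complex.I * (a.re : ℂ)) = (A n : ℂ) := by
    intro n
    rw [jacobiTheta₂_term, hA]
    push_cast
    congr 1
    linear_combination (Real.pi * (n:ℂ)^2 * a.re) * Complex.I_mul_I
  simp_rw [hterm] at hs
  rw [← jacobiTheta_eq_jacobiTheta₂] at hs
  have hsA : Summable A := Complex.summable_ofReal.1 hs.summable
  have hval : jacobiTheta (Complex.I * (a.re : ℂ)) = ((∑' n, A n : ℝ) : ℂ) := by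
    rw [← hs.tsum_eq, Complex.ofReal_tsum]
  set f : ℤ → ℂ := fun n => Complex.exp (-↑Real.pi * a * (n:ℂ) ^ 2 + 2 * Real.pi * (Complex.I * t) * n)
    with hf
  have hnorm : ∀ n, ‖f n‖ = A n := by
    intro n
    rw [hf, hA]
    simp only [Complex.norm_exp]
    congr 1
    have e : (-↑Real.pi * a * (n:ℂ) ^ 2 + 2 * Real.pi * (Complex.I * t) * n)
      = ((-Real.pi * (n:ℝ)^2 : ℝ) : ℂ) * a + ((2 * Real.pi * t * n : ℝ) : ℂ) * Complex.I := by
      push_cast; ring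
    rw [e, Complex.add_re, Complex.re_ofReal_mul, Complex.re_ofReal_mul]
    simp; ring
  have hsf : Summable f := by
    apply Summable.of_norm; simpa only [hnorm] using hsA
  have hf0 : f 0 = 1 := by simp [hf]
  have hA0 : A 0 = 1 := by simp [hA]
  have e1 : (∑' n, f n) - 1 = ∑' n, if n = 0 then 0 else f n := by
    rw [hsf.tsum_eq_add_tsum_ite 0, hf0]; ring
  have e2 : (∑' n, A n) - 1 = ∑' n, if n = 0 then 0 else A n := by
    rw [hsA.tsum_eq_add_tsum_ite 0, hA0]; ring
  have hn : ∀ n, ‖(if n = 0 then 0 else f n)‖ = if n = 0 then 0 else A n := by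
    intro n; split_ifs <;> simp [hnorm]
  have hsA' : Summable (fun n : ℤ => if n = 0 then 0 else A n) := by
    refine Summable.of_nonneg_of_le (fun n => ?_) (fun n => ?_) hsA
    · split_ifs; exact le_rfl; exact (Real.exp_pos _).le
    · split_ifs; exact (Real.exp_pos _).le; exact le_rfl
  have h3 : ‖(∑' n, f n) - 1‖ ≤ (∑' n, A n) - 1 := by
    rw [e1, e2]
    calc _ ≤ ∑' n, ‖(if n = 0 then 0 else f n)‖ := norm_tsum_le_tsum_norm (by simpa only [hn] using hsA')
      _ = _ := by simp only [hn]
  refine h3.trans ?_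
  have h4 : (∑' n, A n) - 1 ≤ ‖jacobiTheta (Complex.I * (a.re : ℂ)) - 1‖ := by
    rw [hval, ← Complex.ofReal_one, ← Complex.ofReal_sub, Complex.norm_real]
    exact Real.le_norm_self _
  refine h4.trans ?_
  simpa using key

lemma theta_decomp (q : ℕ) [NeZero q] (p : ℤ) (h y : ℝ) (hy : 0 < y) (a : ℂ)
    (ha : a = 1 / ((q:ℂ) ^ 2 * (y - 2 * Complex.I * h))) :
    jacobiTheta (2 * ((p:ℂ) / q + h) + Complex.I * y) =
      a ^ (1/2 : ℂ) * ∑ r : Fin q, ZMod.stdAddChar ((p : ZMod q) * ((r : ℕ) : ZMod q) ^ 2) *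
        ∑' n : ℤ, Complex.exp (-↑Real.pi * a * (n:ℂ) ^ 2 +
          2 * Real.pi * (Complex.I * ((-(r:ℕ) / q : ℝ) : ℂ)) * n) := by
  have hq : (q:ℂ) ≠ 0 := by exact_mod_cast NeZero.ne q
  have hz0 : ((y:ℂ) - 2 * Complex.I * h) ≠ 0 := by
    intro h0
    have := congrArg Complex.re h0
    simp at this; exact hy.ne' this
  have hare : 0 < a.re := by
    have hz : 0 < ((q:ℂ) ^ 2 * (y - 2 * Complex.I * h)).re := by
      have e : ((q:ℂ) ^ 2 * (y - 2 * Complex.I * h)).re = (q:ℝ)^2 * y := by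
        have : ((q:ℂ) ^ 2 * (y - 2 * Complex.I * h)) = (((q:ℝ)^2 : ℝ):ℂ) * (y - 2 * Complex.I * h) := by
          push_cast; rfl
        rw [this, Complex.re_ofReal_mul]; simp
      rw [e]; have : (0:ℝ) < q := by exact_mod_cast NeZero.pos q
      positivity
    rw [ha, one_div, Complex.inv_re]
    exact div_pos hz (Complex.normSq_pos.2 (by intro h0; rw [h0] at hz; simp at hz))
  have ha0 : a ≠ 0 := by intro h0; rw [h0] at hare; simp at hare
  have ha2 : a ^ (1/2:ℂ) ≠ 0 := by rw [Complex.cpow_ne_zero_iff]; exact Or.inl ha0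
  have him : 0 < (2 * ((p:ℂ) / q + h) + Complex.I * y).im := by
    have : ((p:ℂ) / q).im = 0 := by
      have : ((p:ℂ)/q) = ((p/q : ℝ) : ℂ) := by push_cast; rfl
      rw [this]; exact Complex.ofReal_im _
    simp [this, hy]
  have hs := hasSum_jacobiTheta₂_term 0 him
  rw [← jacobiTheta_eq_jacobiTheta₂] at hs
  have hs2 := (Int.divModEquiv q).symm.hasSum_iff.2 hs
  have hs3 := ((Equiv.prodComm (Fin q) ℤ).hasSum_iff.2 hs2)
  have e := hs3.tsum_eq
  rw [hs3.summable.tsum_prod, tsum_fintype] at e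
  rw [← e, Finset.mul_sum]
  refine Finset.sum_congr rfl fun r _ => ?_
  rw [Complex.tsum_exp_neg_quadratic hare]
  have : ∀ A B C : ℂ, A ≠ 0 → A * (B * (1 / A * C)) = B * C := by
    intro A B C hA; field_simp
  rw [this _ _ _ ha2, ← tsum_mul_left]
  refine tsum_congr fun k => ?_
  have hst : ZMod.stdAddChar ((p : ZMod q) * ((r : ℕ) : ZMod q) ^ 2)
      = Complex.exp (2 * Real.pi * Complex.I * ((p * (r:ℕ)^2 : ℤ) : ℂ) / q) := by
    rw [← ZMod.stdAddChar_coe]; push_cast; rfl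
  rw [hst, ← Complex.exp_add]
  simp only [Function.comp, Equiv.prodComm_apply, Prod.swap, Int.divModEquiv, Equiv.coe_fn_symm_mk,
    jacobiTheta₂_term]
  rw [Complex.exp_eq_exp_iff_exists_int]
  refine ⟨p * (k^2 * q + 2 * k * (r:ℕ)), ?_⟩
  have ha' : (Real.pi : ℂ) / a = Real.pi * ((q:ℂ) ^ 2 * (y - 2 * Complex.I * h)) := by
    rw [ha]; field_simp
  rw [neg_div, ha']
  push_cast
  have hI : Complex.I * (Complex.I * (-((r:ℕ):ℂ) / q)) = (r:ℕ) / q := by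
    rw [← mul_assoc, Complex.I_mul_I]; ring
  rw [hI]
  field_simp
  ring_nf
  simp only [Complex.I_sq]
  ring

lemma sqrt_re_lower (a : ℂ) (ha : 0 < a.re) :
    (a ^ (1/2:ℂ)).re ≥ 7/10 * ‖a ^ (1/2:ℂ)‖ ∧ ‖a ^ (1/2:ℂ)‖ = Real.sqrt ‖a‖ := by
  have ha0 : a ≠ 0 := by intro h0; rw [h0] at ha; simp at ha
  set b := a ^ (1/2:ℂ) with hb
  have hb2 : b ^ 2 = a := by
    rw [hb, ← Complex.cpow_nat_mul]; norm_num
  have hn : ‖b‖ ^ 2 = ‖a‖ := by rw [← norm_pow, hb2]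
  have hre : 0 ≤ b.re := by
    rw [hb, Complex.cpow_def_of_ne_zero ha0, Complex.exp_re]
    refine mul_nonneg (Real.exp_pos _).le ?_
    have e : (Complex.log a * (1/2)).im = a.arg / 2 := by
      rw [show (1/2:ℂ) = ((1/2:ℝ):ℂ) by push_cast; rfl, Complex.im_mul_ofReal, Complex.log_im]; ring
    rw [e]
    apply Real.cos_nonneg_of_mem_Icc
    have h1 := Complex.neg_pi_lt_arg a
    have h2 := Complex.arg_le_pi a
    constructor <;> linarith
  have hr : a.re = b.re ^ 2 - b.im ^ 2 := by
    rw [← hb2, sq, Complex.mul_re]; ring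
  have hn2 : ‖b‖ ^ 2 = b.re ^ 2 + b.im ^ 2 := by
    rw [Complex.sq_norm, Complex.normSq_apply]; ring
  refine ⟨?_, ?_⟩
  · apply le_of_sq_le_sq _ hre
    rw [mul_pow]; nlinarith [sq_nonneg b.re]
  · rw [← hn, Real.sqrt_sq (norm_nonneg _)]

lemma theta_lower (q : ℕ) [NeZero q] (p : ℤ) (hc : IsCoprime p (q:ℤ)) (h4 : q % 4 ≠ 2) :
    ∃ u : ℂ, ‖u‖ = 1 ∧ ∀ h y : ℝ, 0 < y → |h| ≤ y →
      20 * Real.sqrt q ≤ Real.exp (Real.pi / (5 * q ^ 2 * y)) → q * y ≤ 1 / 49 →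
      1 / (20 * Real.sqrt (q * y)) ≤
        (u * ((jacobiTheta (2 * ((p:ℂ) / q + h) + Complex.I * y) - 1) / 2)).re := by
  have hG := gauss_lower q p hc h4
  set G := ∑ r : ZMod q, ZMod.stdAddChar ((p : ZMod q) * r ^ 2) with hGdef
  have hq1 : (1:ℝ) ≤ q := by exact_mod_cast NeZero.pos q
  have hsq1 : 1 ≤ Real.sqrt q := Real.one_le_sqrt.2 hq1
  have hGpos : 0 < ‖G‖ := by linarith
  refine ⟨(starRingEnd ℂ) G / ‖G‖, ?_, ?_⟩
  · rw [norm_div, RCLike.norm_conj, Complex.norm_real, norm_norm, div_self hGpos.ne']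
  set u := (starRingEnd ℂ) G / ‖G‖ with hu
  have hun : ‖u‖ = 1 := by
    rw [hu, norm_div, RCLike.norm_conj, Complex.norm_real, norm_norm, div_self hGpos.ne']
  have huG : u * G = (‖G‖ : ℂ) := by
    rw [hu, div_mul_eq_mul_div, mul_comm, Complex.mul_conj']
    have : (‖G‖:ℂ) ≠ 0 := by exact_mod_cast hGpos.ne'
    field_simp
  intro h y hy hhy hexp hqy
  have hdec := theta_decomp q p h y hy _ rfl
  set a := 1 / ((q:ℂ) ^ 2 * (y - 2 * Complex.I * h)) with ha
  have hare : 1 / (5 * q ^ 2 * y) ≤ a.re := by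
    have e : a = (((1 / (q:ℝ)^2 : ℝ)) : ℂ) * ((y:ℂ) - 2 * Complex.I * h)⁻¹ := by
      rw [ha]; push_cast; rw [one_div, mul_inv, one_div]
    have e2 : Complex.normSq ((y:ℂ) - 2 * Complex.I * h) = y^2 + 4 * h^2 := by
      rw [Complex.normSq_apply]; simp; ring
    rw [e, Complex.re_ofReal_mul, Complex.inv_re, e2]
    have e3 : ((y:ℂ) - 2 * Complex.I * h).re = y := by simp
    rw [e3]
    have hh : h ^ 2 ≤ y ^ 2 := by
      rw [← sq_abs h]; gcongr
    rw [div_mul_div_comm, div_le_div_iff₀ (by positivity) (by positivity)]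
    have : (q:ℝ)^2 * (h^2) ≤ q^2 * y^2 := by gcongr
    nlinarith
  have hA0 : 0 < 1 / (5 * (q:ℝ) ^ 2 * y) := by positivity
  have hapos : 0 < a.re := lt_of_lt_of_le hA0 hare
  obtain ⟨hb1, hb2⟩ := sqrt_re_lower a hapos
  set b := a ^ (1/2:ℂ) with hb
  set D := 2 / (1 - Real.exp (-Real.pi * a.re)) * Real.exp (-Real.pi * a.re) with hD
  have hEle : Real.exp (-Real.pi * a.re) ≤ 1 / (20 * Real.sqrt q) := by
    have h1 : Real.exp (-Real.pi * a.re) ≤ Real.exp (- (Real.pi / (5 * q ^ 2 * y))) := by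
      rw [Real.exp_le_exp]
      have : Real.pi * (1 / (5 * (q:ℝ) ^ 2 * y)) ≤ Real.pi * a.re := by gcongr
      have e : Real.pi * (1 / (5 * (q:ℝ) ^ 2 * y)) = Real.pi / (5 * q ^ 2 * y) := by ring
      linarith
    refine h1.trans ?_
    rw [Real.exp_neg, ← one_div]
    gcongr
  have hE20 : Real.exp (-Real.pi * a.re) ≤ 1/20 := by
    refine hEle.trans ?_
    gcongr; linarith
  have hDle : D ≤ 2 / (19 * Real.sqrt q) := by
    have h1 : 2 / (1 - Real.exp (-Real.pi * a.re)) ≤ 2 / (19/20) := by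
      gcongr; linarith
    calc D ≤ 2 / (19/20) * (1 / (20 * Real.sqrt q)) := by rw [hD]; gcongr
      _ = _ := by field_simp
  -- error term
  set E : Fin q → ℂ := fun r => (∑' n : ℤ, Complex.exp (-↑Real.pi * a * (n:ℂ) ^ 2 +
          2 * Real.pi * (Complex.I * ((-(r:ℕ) / q : ℝ) : ℂ)) * n)) - 1 with hE
  have hEn : ∀ r, ‖E r‖ ≤ D := fun r => theta_remainder a hapos _
  have hGfin : G = ∑ r : Fin q, ZMod.stdAddChar ((p : ZMod q) * ((r : ℕ) : ZMod q) ^ 2) := by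
    rw [hGdef]
    obtain ⟨m, rfl⟩ : ∃ m, q = m + 1 := ⟨q - 1, by have := NeZero.pos q; omega⟩
    refine Finset.sum_congr rfl fun r _ => ?_
    congr 3
    exact (Fin.cast_val_eq_self r).symm
  have hJ : jacobiTheta (2 * ((p:ℂ) / q + h) + Complex.I * y) =
      b * G + b * ∑ r : Fin q, ZMod.stdAddChar ((p : ZMod q) * ((r : ℕ) : ZMod q) ^ 2) * E r := by
    rw [hdec, hGfin, ← mul_add, ← Finset.sum_add_distrib]
    congr 1
    refine Finset.sum_congr rfl fun r _ => ?_
    rw [hE]; ring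
  set R := b * ∑ r : Fin q, ZMod.stdAddChar ((p : ZMod q) * ((r : ℕ) : ZMod q) ^ 2) * E r with hR
  have hRn : ‖R‖ ≤ ‖b‖ * (q * D) := by
    rw [hR, norm_mul]
    gcongr
    calc _ ≤ ∑ r : Fin q, ‖ZMod.stdAddChar ((p : ZMod q) * ((r : ℕ) : ZMod q) ^ 2) * E r‖ :=
          norm_sum_le _ _
      _ ≤ ∑ r : Fin q, D := by
          refine Finset.sum_le_sum fun r _ => ?_
          rw [norm_mul, AddChar.norm_apply, one_mul]; exact hEn r
      _ = q * D := by simp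
  have hqs : Real.sqrt q * Real.sqrt q = q := Real.mul_self_sqrt (by positivity)
  have hqD : q * D ≤ 2/19 * Real.sqrt q := by
    calc q * D ≤ q * (2 / (19 * Real.sqrt q)) := by gcongr
      _ = _ := by
        nth_rewrite 1 [← hqs]; field_simp
  have hbn : 1 / (Real.sqrt 5 * q * Real.sqrt y) ≤ ‖b‖ := by
    rw [hb2]
    apply Real.le_sqrt_of_sq_le
    have : (1 / (Real.sqrt 5 * q * Real.sqrt y)) ^ 2 = 1 / (5 * q ^ 2 * y) := by
      rw [div_pow, mul_pow, mul_pow, Real.sq_sqrt (by norm_num), Real.sq_sqrt hy.le, one_pow]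
    rw [this]
    exact hare.trans (Complex.re_le_norm a)
  have hre : (u * ((jacobiTheta (2 * ((p:ℂ) / q + h) + Complex.I * y) - 1) / 2)).re
      = (‖G‖ * b.re + (u * R).re - u.re) / 2 := by
    rw [hJ]
    have : u * ((b * G + R - 1) / 2) = (((1/2 : ℝ)):ℂ) * ((u * G) * b + u * R - u) := by
      push_cast; ring
    rw [this, huG, Complex.re_ofReal_mul, Complex.sub_re, Complex.add_re, Complex.re_ofReal_mul]
    ring
  rw [hre]
  have i1 : -(‖b‖ * (2/19 * Real.sqrt q)) ≤ (u * R).re := by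
    have h1 : ‖u * R‖ ≤ ‖b‖ * (2/19 * Real.sqrt q) := by
      rw [norm_mul, hun, one_mul]
      exact hRn.trans (by gcongr)
    have := Complex.abs_re_le_norm (u * R)
    have := neg_abs_le (u * R).re
    linarith
  have i2 : u.re ≤ 1 := by rw [← hun]; exact Complex.re_le_norm u
  have i3 : Real.sqrt q * (7/10 * ‖b‖) ≤ ‖G‖ * b.re := by gcongr
  have i4 : 1 / (Real.sqrt 5 * Real.sqrt (q * y)) ≤ Real.sqrt q * ‖b‖ := by
    calc _ = Real.sqrt q * (1 / (Real.sqrt 5 * q * Real.sqrt y)) := by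
          rw [Real.sqrt_mul (by positivity)]
          nth_rewrite 3 [← hqs]
          have : 0 < Real.sqrt y := Real.sqrt_pos.2 hy
          field_simp
      _ ≤ _ := by gcongr
  have hw : 0 < Real.sqrt (q * y) := Real.sqrt_pos.2 (by positivity)
  have i5 : Real.sqrt (q * y) ≤ 1/7 := by
    rw [Real.sqrt_le_left (by norm_num)]; linarith
  set W := 1 / Real.sqrt (q * y) with hW
  have i6 : 7 ≤ W := by
    rw [hW, le_div_iff₀ hw]; linarith
  have i7 : 1 / (Real.sqrt 5 * Real.sqrt (q * y)) ≥ 0.44 * W := by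
    have : Real.sqrt 5 ≤ 2.25 := by rw [Real.sqrt_le_left (by norm_num)]; norm_num
    rw [one_div, mul_inv, ← one_div (Real.sqrt (q*y))]
    have : 0.44 ≤ (Real.sqrt 5)⁻¹ := by
      rw [le_inv_comm₀ (by norm_num) (by positivity)]; refine this.trans (by norm_num)
    gcongr
  have i8 : 1 / (20 * Real.sqrt (q * y)) = W / 20 := by rw [hW]; field_simp
  rw [i8]
  nlinarith

/-- Abel summation bound. -/
lemma abel_bound (a : ℕ → ℂ) (L : ℂ)
    (hL : Tendsto (fun N => ∑ n ∈ Finset.range N, a n) atTop (nhds L)) (C η : ℝ) (hC : 0 < C)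
    (hη : 0 < η) :
    ∃ M : ℕ, ∃ K : ℝ, 0 < K ∧ ∀ v : ℕ → ℝ, Monotone v → (∀ n, 0 ≤ v n) → (∀ n, v n ≤ C) →
      ∀ N, M ≤ N → ‖∑ n ∈ Finset.range N, a n * (v n : ℂ)‖ ≤ η + K * v M := by
  set R : ℕ → ℂ := fun N => (∑ n ∈ Finset.range N, a n) - L with hR
  have hR0 : Tendsto R atTop (nhds 0) := by
    have := hL.sub_const L; simpa [hR] using this
  obtain ⟨B, hB⟩ : ∃ B, ∀ n, ‖R n‖ ≤ B := by
    obtain ⟨B, hB⟩ := (Metric.isBounded_range_of_tendsto R hR0).exists_norm_le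
    exact ⟨B, fun n => hB _ ⟨n, rfl⟩⟩
  have hB0 : 0 ≤ B := (norm_nonneg _).trans (hB 0)
  set ε := η / (2 * C) with hε
  have hε0 : 0 < ε := by positivity
  obtain ⟨M, hM⟩ : ∃ M, ∀ n ≥ M, ‖R n‖ ≤ ε := by
    have := (Metric.tendsto_atTop.1 hR0) ε hε0
    obtain ⟨M, hM⟩ := this
    exact ⟨M, fun n hn => by simpa using (hM n hn).le⟩
  refine ⟨M, 2 * B + 1, by positivity, fun v hv h0 hvC N hN => ?_⟩
  -- identity
  have key : ∀ N, ∑ n ∈ Finset.range N, a n * (v n : ℂ)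
      = R N * v N - R 0 * v 0 - ∑ n ∈ Finset.range N, R (n+1) * ((v (n+1) - v n : ℝ) : ℂ) := by
    intro N
    induction N with
    | zero => simp
    | succ N ih =>
      rw [Finset.sum_range_succ, ih, Finset.sum_range_succ]
      have : R (N+1) = R N + a N := by simp only [hR, Finset.sum_range_succ]; ring
      rw [this]; push_cast; ring
  have hsum : ∀ N, M ≤ N → ∑ n ∈ Finset.range N, ‖R (n+1)‖ * (v (n+1) - v n)
      ≤ B * (v M - v 0) + ε * (v N - v M) := by
    intro N hN
    induction N, hN using Nat.le_induction with
    | base =>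
      calc _ ≤ ∑ n ∈ Finset.range M, B * (v (n+1) - v n) := by
            refine Finset.sum_le_sum fun n _ => ?_
            have := hv (Nat.le_succ n)
            exact mul_le_mul_of_nonneg_right (hB _) (sub_nonneg.2 this)
        _ = B * (v M - v 0) := by rw [← Finset.mul_sum, Finset.sum_range_sub]
        _ ≤ _ := by simp
    | succ N hN ih =>
      rw [Finset.sum_range_succ]
      have h1 := hv (Nat.le_succ N)
      have := mul_le_mul_of_nonneg_right (hM (N+1) (by omega)) (sub_nonneg.2 h1)
      simp only [Nat.succ_eq_add_one] at this
      linarith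
  rw [key]
  have hn : ∀ n, ‖(v n : ℂ)‖ = v n := fun n => by
    rw [Complex.norm_real, Real.norm_of_nonneg (h0 n)]
  have h1 : ‖R N * v N‖ ≤ ε * C := by
    rw [norm_mul, hn]
    exact mul_le_mul (hM N hN) (hvC N) (h0 N) hε0.le
  have h2 : ‖R 0 * v 0‖ ≤ B * v M := by
    rw [norm_mul, hn]
    exact mul_le_mul (hB 0) (hv (Nat.zero_le M)) (h0 0) hB0
  have h3 : ‖∑ n ∈ Finset.range N, R (n+1) * ((v (n+1) - v n : ℝ) : ℂ)‖ ≤ B * v M + ε * C := by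
    calc _ ≤ ∑ n ∈ Finset.range N, ‖R (n+1) * ((v (n+1) - v n : ℝ) : ℂ)‖ := norm_sum_le _ _
      _ = ∑ n ∈ Finset.range N, ‖R (n+1)‖ * (v (n+1) - v n) := by
          refine Finset.sum_congr rfl fun n _ => ?_
          rw [norm_mul, Complex.norm_real, Real.norm_of_nonneg (sub_nonneg.2 (hv (Nat.le_succ n)))]
      _ ≤ _ := hsum N hN
      _ ≤ _ := by
        have := h0 0
        have := h0 M
        have := hvC N
        gcongr <;> linarith
  have h4 := norm_sub_le (R N * v N - R 0 * v 0) (∑ n ∈ Finset.range N, R (n+1) * ((v (n+1) - v n : ℝ) : ℂ))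
  have h5 := norm_sub_le (R N * (v N:ℂ)) (R 0 * v 0)
  have h6 : ε * C = η / 2 := by rw [hε]; field_simp
  have := h0 M
  linarith

/-- incomplete Gamma-type function -/
noncomputable def Psi (s t : ℝ) : ℝ := ∫ u in (0:ℝ)..t, u ^ (s/2 - 1) * Real.exp (-Real.pi * u)

lemma Psi_intOn (s : ℝ) (hs : 0 < s) :
    IntegrableOn (fun u : ℝ => u ^ (s/2 - 1) * Real.exp (-Real.pi * u)) (Set.Ioi 0) := by
  have := integrableOn_rpow_mul_exp_neg_mul_rpow (p := 1) (s := s/2-1) (b := Real.pi)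
    (by linarith) one_pos Real.pi_pos
  simpa using this

lemma Psi_ii (s : ℝ) (hs : 0 < s) (a b : ℝ) (ha : 0 ≤ a) (hb : 0 ≤ b) :
    IntervalIntegrable (fun u : ℝ => u ^ (s/2 - 1) * Real.exp (-Real.pi * u)) volume a b := by
  rw [intervalIntegrable_iff]
  refine (Psi_intOn s hs).mono_set ?_
  intro u hu
  rw [Set.uIoc] at hu
  exact lt_of_le_of_lt (le_min ha hb) hu.1

lemma Psi_sub (s : ℝ) (hs : 0 < s) (a b : ℝ) (ha : 0 ≤ a) (hb : 0 ≤ b) :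
    Psi s b - Psi s a = ∫ u in a..b, u ^ (s/2 - 1) * Real.exp (-Real.pi * u) := by
  rw [Psi, Psi]
  exact intervalIntegral.integral_interval_sub_left (Psi_ii s hs 0 b le_rfl hb) (Psi_ii s hs 0 a le_rfl ha)

lemma Psi_mono (s : ℝ) (hs : 0 < s) (a b : ℝ) (ha : 0 ≤ a) (hab : a ≤ b) :
    Psi s a ≤ Psi s b := by
  rw [← sub_nonneg, Psi_sub s hs a b ha (ha.trans hab)]
  apply intervalIntegral.integral_nonneg hab
  intro u hu
  have : 0 ≤ u := ha.trans hu.1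
  positivity

lemma Psi_nonneg (s : ℝ) (hs : 0 < s) (a : ℝ) (ha : 0 ≤ a) : 0 ≤ Psi s a := by
  have := Psi_mono s hs 0 a le_rfl ha
  simpa [Psi] using this

lemma Psi_bdd (s : ℝ) (hs : 0 < s) : ∃ C, 0 < C ∧ ∀ t, 0 ≤ t → Psi s t ≤ C := by
  refine ⟨(∫ u in Set.Ioi (0:ℝ), u ^ (s/2 - 1) * Real.exp (-Real.pi * u)) + 1, ?_, ?_⟩
  · have : 0 ≤ ∫ u in Set.Ioi (0:ℝ), u ^ (s/2 - 1) * Real.exp (-Real.pi * u) := by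
      apply setIntegral_nonneg measurableSet_Ioi
      intro u hu
      have : 0 < u := hu
      positivity
    linarith
  · intro t ht
    rw [Psi, intervalIntegral.integral_of_le ht]
    have : ∫ u in Set.Ioc 0 t, u ^ (s/2 - 1) * Real.exp (-Real.pi * u) ≤
        ∫ u in Set.Ioi (0:ℝ), u ^ (s/2 - 1) * Real.exp (-Real.pi * u) := by
      apply setIntegral_mono_set (Psi_intOn s hs)
      · filter_upwards [ae_restrict_mem measurableSet_Ioi] with u hu
        have : 0 < u := hu
        simp only [Pi.zero_apply]
        positivity
      · exact (Set.Ioc_subset_Ioi_self).eventuallyLE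
    linarith

lemma Psi_small (s : ℝ) (hs : 0 < s) : Tendsto (Psi s) (nhdsWithin 0 (Set.Ici 0)) (nhds 0) := by
  have h : ContinuousOn (Psi s) (Set.Icc 0 1) := by
    have := intervalIntegral.continuousOn_primitive_interval (a := (0:ℝ)) (b := 1) (μ := volume)
      (f := fun u : ℝ => u ^ (s/2 - 1) * Real.exp (-Real.pi * u)) (by
        have := Psi_ii s hs 0 1 le_rfl zero_le_one
        rw [Set.uIcc_of_le zero_le_one]
        rwa [intervalIntegrable_iff_integrableOn_Icc_of_le zero_le_one] at this)
    rw [Set.uIcc_of_le zero_le_one] at this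
    exact this
  have h0 := h 0 (by simp)
  rw [ContinuousWithinAt] at h0
  have e : Psi s 0 = 0 := by simp [Psi]
  rw [e, nhdsWithin_Icc_eq_nhdsGE one_pos] at h0
  exact h0

lemma Psi_scale (s : ℝ) (hs : 0 < s) (m Y1 Y2 : ℝ) (hm : 0 < m) (h1 : 0 < Y1) (h12 : Y1 ≤ Y2) :
    ∫ y in Y1..Y2, y ^ (s/2 - 1) * Real.exp (-Real.pi * m ^ 2 * y)
      = m ^ (-s) * (Psi s (m^2 * Y2) - Psi s (m^2 * Y1)) := by
  have hY2 := h1.trans_le h12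
  rw [Psi_sub s hs _ _ (by positivity) (by positivity)]
  have := intervalIntegral.integral_comp_mul_left (a := Y1) (b := Y2)
    (fun u : ℝ => u ^ (s/2 - 1) * Real.exp (-Real.pi * u)) (c := m^2) (by positivity)
  rw [smul_eq_mul, eq_inv_mul_iff_mul_eq₀ (by positivity)] at this
  rw [← this, ← mul_assoc, ← intervalIntegral.integral_const_mul]
  apply intervalIntegral.integral_congr
  intro y hy
  rw [Set.uIcc_of_le h12] at hy
  have hy0 : 0 < y := h1.trans_le hy.1
  simp only
  rw [Real.mul_rpow (by positivity) hy0.le]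
  have e : m ^ (-s) * m^2 * (m^2) ^ (s/2 - 1) = 1 := by
    rw [← Real.rpow_natCast m 2, ← Real.rpow_mul hm.le, ← Real.rpow_add hm, ← Real.rpow_add hm]
    push_cast
    rw [show -s + 2 + 2 * (s/2 - 1) = 0 by ring, Real.rpow_zero]
  rw [show -Real.pi * (m^2 * y) = -Real.pi * m^2 * y by ring]
  linear_combination (-(y ^ (s/2 - 1) * Real.exp (-Real.pi * m ^ 2 * y))) * e

/-- coefficients of the series, shifted by one -/
noncomputable def coefA (s x : ℝ) (n : ℕ) : ℂ :=
  ((((n:ℝ) + 1) ^ (-s) : ℝ) : ℂ) * Complex.exp (2 * Real.pi * Complex.I * ((n : ℂ) + 1) ^ 2 * (x : ℂ))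

lemma FsN_eq (s x : ℝ) (N : ℕ) : FsN s N x = ∑ n ∈ Finset.range N, coefA s x n := by
  induction N with
  | zero => simp [FsN]
  | succ N ih =>
    rw [Finset.sum_range_succ, ← ih, FsN, Finset.sum_Icc_succ_top (by omega), FsN, coefA]
    push_cast; rfl

/-- The integrand. -/
noncomputable def thInt (s x y : ℝ) : ℂ :=
  ((y ^ (s/2 - 1) : ℝ) : ℂ) * ((jacobiTheta (2 * (x:ℂ) + Complex.I * y) - 1) / 2)

lemma thInt_cont (s x Y1 Y2 : ℝ) (h1 : 0 < Y1) : ContinuousOn (thInt s x) (Set.Icc Y1 Y2) := by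
  intro y hy
  have hy0 : 0 < y := h1.trans_le hy.1
  apply ContinuousAt.continuousWithinAt
  unfold thInt
  have him : 0 < (2 * (x:ℂ) + Complex.I * y).im := by simpa using hy0
  have h2 : ContinuousAt (fun y : ℝ => jacobiTheta (2 * (x:ℂ) + Complex.I * y)) y := by
    have := (differentiableAt_jacobiTheta him).continuousAt
    exact ContinuousAt.comp (f := fun y : ℝ => (2 * (x:ℂ) + Complex.I * y)) this (by fun_prop)
  have h3 : ContinuousAt (fun y : ℝ => ((y ^ (s/2 - 1) : ℝ) : ℂ)) y := by
    have := Real.continuousAt_rpow_const y (s/2-1) (Or.inl hy0.ne')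
    exact Complex.continuous_ofReal.continuousAt.comp this
  exact h3.mul ((h2.sub continuousAt_const).div_const _)

lemma int_hasSum (s x Y1 Y2 : ℝ) (hs : 0 < s) (hs2 : s ≤ 1) (h1 : 0 < Y1) (h12 : Y1 ≤ Y2) :
    HasSum (fun n : ℕ => coefA s x n *
      ((Psi s (((n:ℝ)+1)^2 * Y2) - Psi s (((n:ℝ)+1)^2 * Y1) : ℝ) : ℂ))
      (∫ y in Y1..Y2, thInt s x y) := by
  set F : ℕ → ℝ → ℂ := fun n y => ((y ^ (s/2 - 1) : ℝ) : ℂ) *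
    Complex.exp (Real.pi * Complex.I * ((n:ℂ) + 1) ^ 2 * (2 * (x:ℂ) + Complex.I * y)) with hF
  have hexp : ∀ (n : ℕ) (y : ℝ), Complex.exp (Real.pi * Complex.I * ((n:ℂ) + 1) ^ 2 *
      (2 * (x:ℂ) + Complex.I * y)) =
      Complex.exp (2 * Real.pi * Complex.I * ((n : ℂ) + 1) ^ 2 * (x : ℂ)) *
        ((Real.exp (-Real.pi * ((n:ℝ)+1)^2 * y) : ℝ) : ℂ) := by
    intro n y
    push_cast
    rw [← Complex.exp_add]
    congr 1
    linear_combination (Real.pi * ((n:ℂ)+1)^2 * y) * Complex.I_mul_I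
  have hunit : ∀ n : ℕ, ‖Complex.exp (2 * Real.pi * Complex.I * ((n : ℂ) + 1) ^ 2 * (x : ℂ))‖ = 1 := by
    intro n
    rw [show 2 * Real.pi * Complex.I * ((n : ℂ) + 1) ^ 2 * (x : ℂ)
      = ((2 * Real.pi * ((n:ℝ)+1)^2 * x : ℝ) : ℂ) * Complex.I by push_cast; ring]
    exact Complex.norm_exp_ofReal_mul_I _
  have hintg : ∀ n, ∫ y in Y1..Y2, F n y = coefA s x n *
      ((Psi s (((n:ℝ)+1)^2 * Y2) - Psi s (((n:ℝ)+1)^2 * Y1) : ℝ) : ℂ) := by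
    intro n
    have e : ∀ y, F n y = Complex.exp (2 * Real.pi * Complex.I * ((n : ℂ) + 1) ^ 2 * (x : ℂ)) *
      ((y ^ (s/2 - 1) * Real.exp (-Real.pi * ((n:ℝ)+1)^2 * y) : ℝ) : ℂ) := by
      intro y; rw [hF]; simp only; rw [hexp]; push_cast; ring
    simp_rw [e]
    rw [intervalIntegral.integral_const_mul, intervalIntegral.integral_ofReal,
      Psi_scale s hs _ Y1 Y2 (by positivity) h1 h12, coefA]
    push_cast; ring
  simp_rw [← hintg]
  have hmem : ∀ t, t ∈ Set.uIoc Y1 Y2 → Y1 ≤ t := by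
    intro t ht
    rw [Set.uIoc_of_le h12] at ht
    exact ht.1.le
  refine intervalIntegral.hasSum_integral_of_dominated_convergence
    (fun n _ => Y1 ^ (s/2 - 1) * Real.exp (-Real.pi * ((n:ℝ)+1)^2 * Y1)) ?_ ?_ ?_ ?_ ?_
  · intro n
    have : Measurable (F n) := by rw [hF]; fun_prop
    exact this.aestronglyMeasurable
  · intro n
    refine Eventually.of_forall fun t ht => ?_
    have ht1 := hmem t ht
    have ht0 : 0 < t := h1.trans_le ht1
    rw [hF]; simp only
    rw [hexp, norm_mul, norm_mul, hunit, one_mul, Complex.norm_real, Complex.norm_real,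
      Real.norm_of_nonneg (by positivity), Real.norm_of_nonneg (by positivity)]
    gcongr ?_ * ?_
    · exact Real.rpow_le_rpow_of_nonpos h1 ht1 (by linarith)
    · rw [Real.exp_le_exp]
      have : Real.pi * ((n:ℝ)+1)^2 * Y1 ≤ Real.pi * ((n:ℝ)+1)^2 * t := by gcongr
      linarith
  · refine Eventually.of_forall fun t ht => ?_
    apply Summable.mul_left
    have him : 0 < (2 * (x:ℂ) + Complex.I * Y1).im := by simpa using h1
    have := (hasSum_nat_jacobiTheta him).summable.norm
    refine this.congr fun n => ?_
    rw [hexp, norm_mul, hunit, one_mul, Complex.norm_real, Real.norm_of_nonneg (by positivity)]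
  · exact intervalIntegrable_const
  · refine Eventually.of_forall fun t ht => ?_
    have ht0 : 0 < t := h1.trans_le (hmem t ht)
    have him : 0 < (2 * (x:ℂ) + Complex.I * t).im := by simpa using ht0
    exact (hasSum_nat_jacobiTheta him).mul_left _

lemma conv_small (s x : ℝ) (hs : 0 < s) (hs2 : s ≤ 1) (L : ℂ)
    (hL : Tendsto (fun N : ℕ => FsN s N x) atTop (nhds L)) (ε : ℝ) (hε : 0 < ε) :
    ∃ δ > 0, ∀ Y1 Y2, 0 < Y1 → Y1 ≤ Y2 → Y2 < δ → ‖∫ y in Y1..Y2, thInt s x y‖ ≤ ε := by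
  simp_rw [FsN_eq] at hL
  obtain ⟨C, hC, hPC⟩ := Psi_bdd s hs
  obtain ⟨M, K, hK, hab⟩ := abel_bound _ L hL C (ε/4) hC (by positivity)
  have hsm := Psi_small s hs
  rw [Metric.tendsto_nhdsWithin_nhds] at hsm
  obtain ⟨d, hd, hdP⟩ := hsm (ε/(4*K)) (by positivity)
  refine ⟨d / ((M:ℝ)+1)^2, by positivity, fun Y1 Y2 h1 h12 h2 => ?_⟩
  have hY2 : 0 < Y2 := h1.trans_le h12
  have hV : ∀ Y, 0 < Y → Y < d / ((M:ℝ)+1)^2 → ∀ N, M ≤ N →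
      ‖∑ n ∈ Finset.range N, coefA s x n * ((Psi s (((n:ℝ)+1)^2 * Y) : ℝ) : ℂ)‖ ≤ ε / 2 := by
    intro Y hY hYd N hN
    have := hab (fun n => Psi s (((n:ℝ)+1)^2 * Y)) ?_ ?_ ?_ N hN
    · refine this.trans ?_
      have hlt : ((M:ℝ)+1)^2 * Y < d := by
        rw [lt_div_iff₀ (by positivity)] at hYd; linarith
      have h3 := hdP (x := ((M:ℝ)+1)^2 * Y) (by simp only [Set.mem_Ici]; positivity) (by
        rw [Real.dist_eq, sub_zero, abs_of_pos (by positivity)]; exact hlt)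
      rw [Real.dist_eq, sub_zero] at h3
      have h4 := (le_abs_self _).trans h3.le
      have : K * Psi s (((M:ℝ)+1)^2 * Y) ≤ K * (ε/(4*K)) := by gcongr
      have e : K * (ε/(4*K)) = ε/4 := by field_simp
      linarith
    · intro m n hmn
      apply Psi_mono s hs _ _ (by positivity)
      have : (m:ℝ) ≤ n := by exact_mod_cast hmn
      gcongr
    · intro n; exact Psi_nonneg s hs _ (by positivity)
    · intro n; exact hPC _ (by positivity)
  have ht := ((int_hasSum s x Y1 Y2 hs hs2 h1 h12).tendsto_sum_nat).norm
  refine le_of_tendsto ht ?_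
  filter_upwards [eventually_ge_atTop M] with N hN
  have e : ∑ n ∈ Finset.range N, coefA s x n *
      ((Psi s (((n:ℝ)+1)^2 * Y2) - Psi s (((n:ℝ)+1)^2 * Y1) : ℝ) : ℂ)
      = (∑ n ∈ Finset.range N, coefA s x n * ((Psi s (((n:ℝ)+1)^2 * Y2) : ℝ) : ℂ))
       - ∑ n ∈ Finset.range N, coefA s x n * ((Psi s (((n:ℝ)+1)^2 * Y1) : ℝ) : ℂ) := by
    rw [← Finset.sum_sub_distrib]
    refine Finset.sum_congr rfl fun n _ => ?_
    push_cast; ring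
  rw [e]
  have := norm_sub_le (∑ n ∈ Finset.range N, coefA s x n * ((Psi s (((n:ℝ)+1)^2 * Y2) : ℝ) : ℂ))
    (∑ n ∈ Finset.range N, coefA s x n * ((Psi s (((n:ℝ)+1)^2 * Y1) : ℝ) : ℂ))
  have a1 := hV Y2 hY2 h2 N hN
  have a2 := hV Y1 h1 (h12.trans_lt h2) N hN
  linarith

/-- `sigTerm` as a function of the two denominators. -/
noncomputable def sg (s q q' : ℝ) : ℝ :=
  (if s < 1 then 1 else Real.log (q' / q)) * Real.sqrt (q' / (q * q') ^ s)

lemma sg_growth (s c0 : ℝ) (hs : 1/2 < s) (hs2 : s ≤ 1) (hc0 : 0 < c0) :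
    ∃ c η : ℝ, 0 < c ∧ 0 < η ∧ ∀ q q' : ℝ, 1 ≤ q → q ≤ q' → c0 ≤ sg s q q' →
      c * q ^ η ≤ q' / q := by
  rcases hs2.lt_or_eq with h | h
  · have h1s : 0 < 1 - s := by linarith
    refine ⟨(c0^2) ^ (1/(1-s)), (2*s-1)/(1-s), by positivity, div_pos (by linarith) h1s, ?_⟩
    intro q q' hq hqq hc
    have hq0 : 0 < q := by linarith
    have hq'0 : 0 < q' := by linarith
    rw [sg, if_pos h, one_mul] at hc
    have h2 : c0^2 ≤ q' / (q*q')^s := by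
      rw [← Real.sq_sqrt (show 0 ≤ q' / (q*q')^s by positivity)]
      gcongr
    set ρ := q'/q with hρ
    have hρ0 : 0 < ρ := by positivity
    have e1 : q' / (q*q')^s = ρ ^ (1-s) * q ^ (-(2*s-1)) := by
      have : q' = ρ * q := by rw [hρ]; field_simp
      rw [this, show q * (ρ * q) = ρ * (q * q) by ring, Real.mul_rpow hρ0.le (by positivity),
        Real.mul_rpow hq0.le hq0.le, Real.rpow_sub hρ0, Real.rpow_neg hq0.le,
        Real.rpow_sub hq0, Real.rpow_one, Real.rpow_one, two_mul, Real.rpow_add hq0]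
      field_simp
    have h3 : c0^2 * q^(2*s-1) ≤ ρ^(1-s) := by
      rw [e1, Real.rpow_neg hq0.le, ← div_eq_mul_inv, le_div_iff₀ (by positivity)] at h2
      exact h2
    have h4 := Real.rpow_le_rpow (by positivity) h3 (show 0 ≤ 1/(1-s) by positivity)
    rw [Real.mul_rpow (by positivity) (by positivity), ← Real.rpow_mul hq0.le,
      ← Real.rpow_mul hρ0.le, mul_one_div_cancel h1s.ne', Real.rpow_one, mul_one_div] at h4
    exact h4
  · refine ⟨c0, 1/2, hc0, by norm_num, ?_⟩
    intro q q' hq hqq hc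
    have hq0 : 0 < q := by linarith
    have hq'0 : 0 < q' := by linarith
    rw [sg, if_neg (by linarith), h, Real.rpow_one] at hc
    have e : q' / (q * q') = 1 / q := by field_simp
    rw [e, Real.sqrt_div zero_le_one, Real.sqrt_one, mul_one_div, le_div_iff₀ (by positivity)] at hc
    rw [← Real.sqrt_eq_rpow]
    exact hc.trans ((Real.log_le_sub_one_of_pos (by positivity)).trans (by linarith))

lemma growth_exp (c η : ℝ) (hc : 0 < c) (hη : 0 < η) :
    ∀ᶠ q : ℝ in atTop, 4 ≤ Real.sqrt (c * q ^ η) ∧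
      20 * Real.sqrt q ≤ Real.exp (Real.pi / 5 * Real.sqrt (c * q ^ η)) := by
  have ht : Tendsto (fun q : ℝ => q ^ (η/2)) atTop atTop := tendsto_rpow_atTop (by positivity)
  have h1 := (isLittleO_rpow_exp_pos_mul_atTop (1/η)
    (show 0 < Real.pi / 5 * Real.sqrt c by positivity)).comp_tendsto ht
  have h2 := h1.bound (show (0:ℝ) < 1/20 by norm_num)
  filter_upwards [h2, ht.eventually_ge_atTop (4 / Real.sqrt c), eventually_gt_atTop 0] with q a1 a2 a3
  have e : Real.sqrt (c * q ^ η) = Real.sqrt c * q ^ (η/2) := by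
    rw [Real.sqrt_mul hc.le, Real.sqrt_eq_rpow (q^η), ← Real.rpow_mul a3.le]; ring_nf
  rw [e]
  have hsc : 0 < Real.sqrt c := Real.sqrt_pos.2 hc
  refine ⟨?_, ?_⟩
  · rw [div_le_iff₀ hsc] at a2; linarith
  · simp only [Function.comp] at a1
    rw [Real.norm_of_nonneg (by positivity), Real.norm_of_nonneg (by positivity),
      ← Real.rpow_mul a3.le, show η/2 * (1/η) = 1/2 by field_simp, ← Real.sqrt_eq_rpow] at a1
    rw [← mul_assoc]; linarith

lemma lower_int (s : ℝ) (hs : 1/2 < s) (hs2 : s ≤ 1) :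
    ∃ κ : ℝ, 0 < κ ∧ ∀ q q' Y1 Y2 : ℝ, 1 ≤ q → q ≤ q' → 4 ≤ Real.sqrt (q'/q) →
      Y1 = 1 / (q * q') → Y2 = Y1 * Real.sqrt (q'/q) →
      κ * sg s q q' ≤ ∫ y in Y1..Y2, y ^ (s/2-1) * (1 / (20 * Real.sqrt (q * y))) := by
  have hform : ∀ q y : ℝ, 0 < q → 0 < y → y ^ (s/2-1) * (1 / (20 * Real.sqrt (q * y)))
      = (1/20 * (1 / Real.sqrt q)) * y ^ ((s-3)/2) := by
    intro q y hq hy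
    rw [Real.sqrt_mul hq.le, show (s-3)/2 = (s/2-1) - 1/2 by ring, Real.rpow_sub hy (s/2-1) (1/2),
      ← Real.sqrt_eq_rpow]
    have := Real.sqrt_pos.2 hq
    have := Real.sqrt_pos.2 hy
    field_simp
  have hintg : ∀ q Y1 Y2 : ℝ, 0 < q → 0 < Y1 → Y1 ≤ Y2 →
      ∫ y in Y1..Y2, y ^ (s/2-1) * (1 / (20 * Real.sqrt (q * y))) =
      (1/20 * (1 / Real.sqrt q)) * ∫ y in Y1..Y2, y ^ ((s-3)/2) := by
    intro q Y1 Y2 hq h1 h12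
    rw [← intervalIntegral.integral_const_mul]
    apply intervalIntegral.integral_congr
    intro y hy
    rw [Set.uIcc_of_le h12] at hy
    exact hform q y hq (h1.trans_le hy.1)
  rcases hs2.lt_or_eq with h | h
  · refine ⟨1/20 * 2 ^ ((s-3)/2), by positivity, ?_⟩
    intro q q' Y1 Y2 hq hqq h4 hY1 hY2
    have hq0 : 0 < q := by linarith
    have hq'0 : 0 < q' := by linarith
    have hY10 : 0 < Y1 := by rw [hY1]; positivity
    have h12 : 2 * Y1 ≤ Y2 := by rw [hY2]; nlinarith
    rw [hintg q Y1 Y2 hq0 hY10 (by linarith), sg, if_pos h, one_mul]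
    have hii : ∀ a b : ℝ, 0 < a → a ≤ b → IntervalIntegrable (fun y : ℝ => y ^ ((s-3)/2)) volume a b := by
      intro a b ha hab
      apply intervalIntegral.intervalIntegrable_rpow
      right; rw [Set.uIcc_of_le hab]; intro h0; linarith [h0.1]
    have hA : Y1 * (2*Y1) ^ ((s-3)/2) ≤ ∫ y in Y1..Y2, y ^ ((s-3)/2) := by
      rw [← intervalIntegral.integral_add_adjacent_intervals (hii Y1 (2*Y1) hY10 (by linarith))
        (hii (2*Y1) Y2 (by linarith) h12)]
      have b1 : 0 ≤ ∫ y in (2*Y1)..Y2, y ^ ((s-3)/2) := by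
        apply intervalIntegral.integral_nonneg h12
        intro y hy
        have : 0 < y := by linarith [hy.1]
        positivity
      have b2 : ∫ y in Y1..(2*Y1), (2*Y1) ^ ((s-3)/2) ≤ ∫ y in Y1..(2*Y1), y ^ ((s-3)/2) := by
        apply intervalIntegral.integral_mono_on (by linarith) intervalIntegrable_const
          (hii Y1 (2*Y1) hY10 (by linarith))
        intro y hy
        exact Real.rpow_le_rpow_of_nonpos (by linarith [hy.1]) hy.2 (by linarith)
      rw [intervalIntegral.integral_const, smul_eq_mul] at b2
      have : (2*Y1 - Y1) = Y1 := by ring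
      rw [this] at b2
      linarith
    have hB : Real.sqrt (q' / (q*q')^s) = (1 / Real.sqrt q) * Y1 ^ ((s-1)/2) := by
      have e1 : q' / (q*q')^s = (1/q) * Y1 ^ (s-1) := by
        rw [hY1, one_div (q*q'), Real.inv_rpow (by positivity), ← Real.rpow_neg (by positivity),
          show -(s-1) = 1 - s by ring, Real.rpow_sub (by positivity), Real.rpow_one]
        field_simp
      rw [e1, Real.sqrt_mul (by positivity), Real.sqrt_div zero_le_one, Real.sqrt_one,
        Real.sqrt_eq_rpow (Y1 ^ (s-1)), ← Real.rpow_mul hY10.le]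
      ring_nf
    have hC : Y1 * (2*Y1) ^ ((s-3)/2) = 2 ^ ((s-3)/2) * Y1 ^ ((s-1)/2) := by
      rw [Real.mul_rpow (by norm_num) hY10.le, show (s-1)/2 = (s-3)/2 + 1 by ring,
        Real.rpow_add hY10, Real.rpow_one]; ring
    rw [hC] at hA
    rw [hB]
    calc _ = (1/20 * (1 / Real.sqrt q)) * (2 ^ ((s-3)/2) * Y1 ^ ((s-1)/2)) := by ring
      _ ≤ _ := by gcongr
  · refine ⟨1/40, by norm_num, ?_⟩
    intro q q' Y1 Y2 hq hqq h4 hY1 hY2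
    have hq0 : 0 < q := by linarith
    have hq'0 : 0 < q' := by linarith
    have hY10 : 0 < Y1 := by rw [hY1]; positivity
    have h12 : 2 * Y1 ≤ Y2 := by rw [hY2]; nlinarith
    rw [hintg q Y1 Y2 hq0 hY10 (by linarith), sg, if_neg (by linarith), h, Real.rpow_one]
    have e : q' / (q * q') = 1 / q := by field_simp
    rw [e, Real.sqrt_div zero_le_one, Real.sqrt_one]
    have e2 : ∫ y in Y1..Y2, y ^ (((1:ℝ)-3)/2) = Real.log (q'/q) / 2 := by
      have : ((1:ℝ)-3)/2 = -1 := by norm_num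
      simp_rw [this, Real.rpow_neg_one]
      rw [integral_inv_of_pos hY10 (by linarith), hY2, mul_div_cancel_left₀ _ hY10.ne',
        Real.log_sqrt (by positivity)]
    rw [e2]
    apply le_of_eq; ring

/-- For `s ∈ (1/2,1]` and an irrational `x ∈ (0,1)`, if the limsup over
indices `j` with `q_j ≢ 2 (mod 4)` of `δ_j √(q_{j+1}/(q_j q_{j+1})^s)` is strictly positive,
then `F_{s,N}(x)` does not converge as `N → ∞`. -/
theorem not_converges_of_limsup_pos (s : ℝ) (hs : s ∈ Set.Ioc (1/2 : ℝ) 1)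
    (x : ℝ) (hx : x ∈ Set.Ioo (0 : ℝ) 1) (hirr : Irrational x)
    (hcond : 0 < Filter.limsup (fun j => ENNReal.ofReal (sigTerm s x j)) (oddFilter x)) :
    ¬ ∃ L : ℂ, Filter.Tendsto (fun N : ℕ => FsN s N x) Filter.atTop (nhds L) := by
  rintro ⟨L, hL⟩
  have hs0 : 0 < s := by linarith [hs.1]
  obtain ⟨c, hc0, hc⟩ := exists_between hcond
  have hfreq := Filter.frequently_lt_of_lt_limsup (by isBoundedDefault) hc
  have hctop : c ≠ ⊤ := (lt_of_lt_of_le hc le_top).ne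
  set c0 := c.toReal with hc0def
  have hc0pos : 0 < c0 := ENNReal.toReal_pos hc0.ne' hctop
  obtain ⟨cg, η, hcg, hη, hgrow⟩ := sg_growth s c0 hs.1 hs.2 hc0pos
  obtain ⟨κ, hκ, hlow⟩ := lower_int s hs.1 hs.2
  obtain ⟨δ, hδ, hsmall⟩ := conv_small s x hs0 hs.2 L hL (κ * c0 / 2) (by positivity)
  -- the denominators tend to infinity
  have hQ : Tendsto (fun j => (cfQ x j : ℝ)) atTop atTop := by
    have : Tendsto (fun j => (cfQ x (j+1) : ℝ)) atTop atTop := by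
      refine tendsto_atTop_mono (fun j => ?_) tendsto_natCast_atTop_atTop
      exact_mod_cast (cfQ_facts x hx hirr j).2.2
    exact (tendsto_add_atTop_iff_nat 1).1 this
  have hev : ∀ᶠ j in oddFilter x, (cfQ x j % 4 ≠ 2) ∧ 49 ≤ (cfQ x j : ℝ) ∧ 1 / δ < (cfQ x j : ℝ) ∧
      (4 ≤ Real.sqrt (cg * (cfQ x j : ℝ) ^ η) ∧ 20 * Real.sqrt (cfQ x j : ℝ) ≤
        Real.exp (Real.pi / 5 * Real.sqrt (cg * (cfQ x j : ℝ) ^ η))) := by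
    have i1 : ∀ᶠ j in oddFilter x, j ∈ {j : ℕ | 1 ≤ j ∧ cfQ x j % 4 ≠ 2} :=
      (Filter.mem_inf_of_right (Filter.mem_principal_self _))
    have i2 : oddFilter x ≤ atTop := inf_le_left
    filter_upwards [i1, i2 (hQ.eventually_ge_atTop 49), i2 (hQ.eventually_gt_atTop (1/δ)),
      i2 (hQ.eventually (growth_exp cg η hcg hη))] with j h1 h2 h3 h4
    exact ⟨h1.2, h2, h3, h4⟩
  obtain ⟨j, hj, hmod, hq49, hqδ, hg4, hgexp⟩ := (hfreq.and_eventually hev).exists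
  have hsig : c0 < sigTerm s x j := (ENNReal.lt_ofReal_iff_toReal_lt hctop).1 hj
  have hsgeq : sigTerm s x j = sg s (cfQ x j) (cfQ x (j+1)) := rfl
  have hH := cfH_le x hx hirr j
  have hqq' : (cfQ x j : ℝ) ≤ cfQ x (j+1) := by exact_mod_cast (cfQ_facts x hx hirr j).2.1
  have hcop := cf_coprime x j
  have hxe : x = (cfP x j : ℝ) / (cfQ x j : ℝ) + cfH x j := by rw [cfH]; ring
  rw [hsgeq] at hsig
  have hqz1 : 1 ≤ cfQ x j := (cfQ_facts x hx hirr j).1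
  obtain ⟨n, hn⟩ : ∃ n : ℕ, cfQ x j = n := ⟨(cfQ x j).toNat, by omega⟩
  rw [hn] at hcop hmod hqz1
  have hnR : (cfQ x j : ℝ) = n := by rw [hn]; simp
  rw [hnR] at hsig hqq' hq49 hqδ hg4 hgexp hH hxe
  set q' : ℝ := ((cfQ x (j+1) : ℤ) : ℝ) with hq'
  have : NeZero n := ⟨by omega⟩
  obtain ⟨u, hu, hth⟩ := theta_lower n (cfP x j) hcop (by omega)
  have hgr := hgrow n q' (by linarith) hqq' hsig.le
  have hn0 : (0:ℝ) < n := by linarith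
  have hq'0 : 0 < q' := by linarith
  set ρ := q' / n with hρ
  have hρ0 : 0 < ρ := by positivity
  have hsq : Real.sqrt (cg * (n:ℝ) ^ η) ≤ Real.sqrt ρ := Real.sqrt_le_sqrt hgr
  have h4ρ : 4 ≤ Real.sqrt ρ := hg4.trans hsq
  have hexpρ : 20 * Real.sqrt n ≤ Real.exp (Real.pi / 5 * Real.sqrt ρ) := by
    refine hgexp.trans (Real.exp_le_exp.2 ?_)
    gcongr
  set Y1 := 1 / (n * q') with hY1
  set Y2 := Y1 * Real.sqrt ρ with hY2
  have hY10 : 0 < Y1 := by positivity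
  have h12 : Y1 ≤ Y2 := by rw [hY2]; nlinarith
  have hY2e : Y2 * (n ^ 2 * Real.sqrt ρ) = 1 := by
    have : Real.sqrt ρ * Real.sqrt ρ = ρ := Real.mul_self_sqrt hρ0.le
    calc Y2 * (n ^ 2 * Real.sqrt ρ) = Y1 * n^2 * (Real.sqrt ρ * Real.sqrt ρ) := by rw [hY2]; ring
      _ = 1 := by rw [this, hY1, hρ]; field_simp
  have hY20 : 0 < Y2 := hY10.trans_le h12
  have hnY2 : n * Y2 ≤ 1 / 49 := by
    have : 49 * (n * Y2) ≤ n * (n * Y2) * Real.sqrt ρ := by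
      have : 0 < n * Y2 := by positivity
      nlinarith [mul_le_mul_of_nonneg_right hq49 this.le]
    have e : n * (n * Y2) * Real.sqrt ρ = 1 := by rw [← hY2e]; ring
    linarith
  have hY2δ : Y2 < δ := by
    have h1 : 1 < δ * n := by rw [div_lt_iff₀ hδ] at hqδ; linarith
    have h2 : n * Y2 < δ * n := by linarith
    nlinarith
  have hI := hsmall Y1 Y2 hY10 h12 hY2δ
  have hL2 := hlow n q' Y1 Y2 (by linarith) hqq' h4ρ hY1 hY2
  have hcont := thInt_cont s x Y1 Y2 hY10
  have hiTh : IntervalIntegrable (thInt s x) volume Y1 Y2 :=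
    ContinuousOn.intervalIntegrable (by rwa [Set.uIcc_of_le h12])
  have hiu : IntervalIntegrable (fun y => u * thInt s x y) volume Y1 Y2 := hiTh.const_mul u
  have hre : (u * ∫ y in Y1..Y2, thInt s x y).re = ∫ y in Y1..Y2, (u * thInt s x y).re := by
    rw [← intervalIntegral.integral_const_mul]
    exact (Complex.reCLM.intervalIntegral_comp_comm hiu).symm
  have hxc : (x:ℂ) = (cfP x j : ℂ) / (n:ℂ) + (cfH x j : ℂ) := by
    have := congrArg (fun t : ℝ => (t:ℂ)) hxe
    simpa using this
  have hge : ∫ y in Y1..Y2, y ^ (s/2-1) * (1 / (20 * Real.sqrt (n * y)))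
      ≤ ∫ y in Y1..Y2, (u * thInt s x y).re := by
    apply intervalIntegral.integral_mono_on h12
    · apply ContinuousOn.intervalIntegrable
      rw [Set.uIcc_of_le h12]
      intro y hy
      have hy0 : 0 < y := hY10.trans_le hy.1
      have : Real.sqrt (n * y) ≠ 0 := (Real.sqrt_pos.2 (by positivity)).ne'
      apply ContinuousAt.continuousWithinAt
      refine (Real.continuousAt_rpow_const y _ (Or.inl hy0.ne')).mul ?_
      refine continuousAt_const.div ?_ (by positivity)
      fun_prop
    · apply ContinuousOn.intervalIntegrable
      rw [Set.uIcc_of_le h12]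
      exact Complex.continuous_re.comp_continuousOn (continuousOn_const.mul hcont)
    · intro y hy
      have hy0 : 0 < y := hY10.trans_le hy.1
      have h1 := hth (cfH x j) y hy0 (hH.trans hy.1) ?_ ?_
      · rw [← hxc] at h1
        have e : (u * thInt s x y).re = y ^ (s/2-1) *
            (u * ((jacobiTheta (2 * (x:ℂ) + Complex.I * y) - 1) / 2)).re := by
          rw [← Complex.re_ofReal_mul, thInt]
          congr 1; ring
        rw [e]
        gcongr
      · refine hexpρ.trans (Real.exp_le_exp.2 ?_)
        rw [le_div_iff₀ (by positivity)]
        have : n ^ 2 * y * Real.sqrt ρ ≤ 1 := by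
          calc n ^ 2 * y * Real.sqrt ρ ≤ n ^ 2 * Y2 * Real.sqrt ρ := by gcongr; exact hy.2
            _ = 1 := by rw [← hY2e]; ring
        calc _ = Real.pi * (n ^ 2 * y * Real.sqrt ρ) := by ring
          _ ≤ Real.pi * 1 := by gcongr
          _ = _ := mul_one _
      · refine le_trans ?_ hnY2
        gcongr; exact hy.2
  have hfin : (u * ∫ y in Y1..Y2, thInt s x y).re ≤ κ * c0 / 2 := by
    refine (Complex.re_le_norm _).trans ?_
    rw [norm_mul, hu, one_mul]; exact hI
  have : κ * c0 < κ * sg s n q' := by gcongr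
  rw [hre] at hfin
  have : 0 < κ * c0 := by positivity
  linarith
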